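/- arXiv:math/0501303 — 3 statements merged into one kernel-verified Lean document; each statement's English description precedes it below -/
import Mathlib

section
/- For every n ≥ 2 and all P, Q ∈ Γ_n, one has T(P‖Q) − h(P‖Q) ≤ 3·[(1/8)·J(P‖Q) − h(P‖Q)]. -/
open Real BigOperators

noncomputable def triangularD {n : ℕ} (p q : Fin n → ℝ) : ℝ :=
  ∑ i, (p i - q i) ^ 2 / (p i + q i)

noncomputable def hellingerD {n : ℕ} (p q : Fin n → ℝ) : ℝ :=
  (1 / 2) * ∑ i, (Real.sqrt (p i) - Real.sqrt (q i)) ^ 2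

noncomputable def symChiSqD {n : ℕ} (p q : Fin n → ℝ) : ℝ :=
  ∑ i, (p i - q i) ^ 2 * (p i + q i) / (p i * q i)

noncomputable def jDiv {n : ℕ} (p q : Fin n → ℝ) : ℝ :=
  ∑ i, (p i - q i) * Real.log (p i / q i)

noncomputable def jsDiv {n : ℕ} (p q : Fin n → ℝ) : ℝ :=
  (1 / 2) * ((∑ i, p i * Real.log (2 * p i / (p i + q i))) +
    (∑ i, q i * Real.log (2 * q i / (p i + q i))))

noncomputable def agDiv {n : ℕ} (p q : Fin n → ℝ) : ℝ :=
  ∑ i, ((p i + q i) / 2) * Real.log ((p i + q i) / (2 * Real.sqrt (p i * q i)))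

noncomputable def dStar {n : ℕ} (p q : Fin n → ℝ) : ℝ :=
  ∑ i, (p i - q i) ^ 4 / Real.sqrt ((p i * q i) ^ 3)

lemma aux_nonneg (F F' : ℝ → ℝ) (h0 : F 0 = 0) (hd : ∀ x, HasDerivAt F (F' x) x)
    (hF : ∀ x, 0 ≤ x → 0 ≤ F' x) : ∀ x, 0 ≤ x → 0 ≤ F x := by
  intro x hx
  have hm : MonotoneOn F (Set.Ici 0) := by
    apply monotoneOn_of_deriv_nonneg (convex_Ici 0)
    · exact fun y _ => (hd y).continuousAt.continuousWithinAt
    · exact fun y _ => (hd y).differentiableAt.differentiableWithinAt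
    · intro y hy
      rw [(hd y).deriv]
      rw [interior_Ici] at hy
      exact hF y (le_of_lt hy)
  have := hm (Set.mem_Ici.2 le_rfl) (Set.mem_Ici.2 hx) hx
  rwa [h0] at this

lemma aux_m : ∀ x : ℝ, 0 ≤ x → 0 ≤ sinh x * cosh x + 3 * x - 4 * (sinh x / cosh x) := by
  apply aux_nonneg (fun x => sinh x * cosh x + 3 * x - 4 * (sinh x / cosh x))
    (fun x => (cosh x * cosh x + sinh x * sinh x) + 3 * 1
      - 4 * ((cosh x * cosh x - sinh x * sinh x) / cosh x ^ 2))
  · simp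
  · intro x
    have hc := (cosh_pos x).ne'
    exact (((hasDerivAt_sinh x).mul (hasDerivAt_cosh x)).add ((hasDerivAt_id x).const_mul 3)).sub
      (((hasDerivAt_sinh x).div (hasDerivAt_cosh x) hc).const_mul 4)
  · intro x _
    have hc := one_le_cosh x
    have h := cosh_sq x
    have : (cosh x * cosh x - sinh x * sinh x) / cosh x ^ 2 ≤ 1 := by
      rw [div_le_one (by positivity)]; nlinarith [sq_nonneg (sinh x)]
    nlinarith [sq_nonneg (sinh x)]

lemma aux_n : ∀ x : ℝ, 0 ≤ x →
    0 ≤ 3 * (x * (sinh x / cosh x)) - 2 * log (cosh x) - 2 * (sinh x / cosh x) ^ 2 := by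
  apply aux_nonneg
    (fun x => 3 * (x * (sinh x / cosh x)) - 2 * log (cosh x) - 2 * (sinh x / cosh x) ^ 2)
    (fun x => (sinh x * cosh x + 3 * x - 4 * (sinh x / cosh x)) / cosh x ^ 2)
  · simp
  · intro x
    have hc := (cosh_pos x).ne'
    have ht := (hasDerivAt_sinh x).div (hasDerivAt_cosh x) hc
    have h := ((((hasDerivAt_id x).mul ht).const_mul 3).sub
      (((hasDerivAt_cosh x).log hc).const_mul 2)).sub ((ht.pow 2).const_mul 2)
    refine h.congr_deriv ?_
    have e : cosh x * cosh x - sinh x * sinh x = 1 := by nlinarith [cosh_sq x]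
    rw [e]
    simp only [id, Pi.div_apply, Nat.add_one_sub_one, pow_one, Nat.cast_ofNat]
    field_simp
    ring
  · intro x hx
    have := aux_m x hx
    positivity

lemma aux_D : ∀ x : ℝ, 0 ≤ x → 0 ≤ 3 * (x * cosh x) - 3 * sinh x - 2 * (sinh x * log (cosh x)) := by
  apply aux_nonneg (fun x => 3 * (x * cosh x) - 3 * sinh x - 2 * (sinh x * log (cosh x)))
    (fun x => cosh x *
      (3 * (x * (sinh x / cosh x)) - 2 * log (cosh x) - 2 * (sinh x / cosh x) ^ 2))
  · simp
  · intro x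
    have hc := (cosh_pos x).ne'
    have h := ((((hasDerivAt_id x).mul (hasDerivAt_cosh x)).const_mul 3).sub
      ((hasDerivAt_sinh x).const_mul 3)).sub
      (((hasDerivAt_sinh x).mul ((hasDerivAt_cosh x).log hc)).const_mul 2)
    refine h.congr_deriv ?_
    simp only [id]
    field_simp
    ring_nf
  · intro x hx
    exact mul_nonneg (cosh_pos x).le (aux_n x hx)

lemma aux_f : ∀ x : ℝ, 0 ≤ x →
    0 ≤ 3 / 2 * (x * sinh x) - cosh x * log (cosh x) - 2 * (cosh x - 1) := by
  apply aux_nonneg (fun x => 3 / 2 * (x * sinh x) - cosh x * log (cosh x) - 2 * (cosh x - 1))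
    (fun x => (3 * (x * cosh x) - 3 * sinh x - 2 * (sinh x * log (cosh x))) / 2)
  · simp
  · intro x
    have hc := (cosh_pos x).ne'
    have h := ((((hasDerivAt_id x).mul (hasDerivAt_sinh x)).const_mul (3 / 2)).sub
      ((hasDerivAt_cosh x).mul ((hasDerivAt_cosh x).log hc))).sub
      (((hasDerivAt_cosh x).sub_const 1).const_mul 2)
    refine h.congr_deriv ?_
    simp only [id]
    field_simp
    ring_nf
  · intro x hx
    have := aux_D x hx
    positivity

lemma aux_f_all (x : ℝ) :
    0 ≤ 3 / 2 * (x * sinh x) - cosh x * log (cosh x) - 2 * (cosh x - 1) := by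
  rcases le_total 0 x with h | h
  · exact aux_f x h
  · have := aux_f (-x) (by linarith)
    rw [sinh_neg, cosh_neg] at this
    linarith

lemma aux_term (p q : ℝ) (hp : 0 < p) (hq : 0 < q) :
    ((p + q) / 2) * Real.log ((p + q) / (2 * Real.sqrt (p * q)))
      + (Real.sqrt p - Real.sqrt q) ^ 2 ≤ 3 / 8 * ((p - q) * Real.log (p / q)) := by
  obtain ⟨a, ha, rfl⟩ : ∃ a : ℝ, 0 < a ∧ p = a ^ 2 :=
    ⟨√p, Real.sqrt_pos.2 hp, (Real.sq_sqrt hp.le).symm⟩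
  obtain ⟨b, hb, rfl⟩ : ∃ b : ℝ, 0 < b ∧ q = b ^ 2 :=
    ⟨√q, Real.sqrt_pos.2 hq, (Real.sq_sqrt hq.le).symm⟩
  rw [← mul_pow, ← div_pow, Real.log_pow, Real.sqrt_sq ha.le, Real.sqrt_sq hb.le,
    Real.sqrt_sq (by positivity)]
  have h := aux_f_all (log (a / b))
  have hab : 0 < a / b := by positivity
  have hc : cosh (log (a / b)) = (a ^ 2 + b ^ 2) / (2 * (a * b)) := by
    rw [cosh_log hab]; field_simp
  have hs : sinh (log (a / b)) = (a ^ 2 - b ^ 2) / (2 * (a * b)) := by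
    rw [sinh_log hab]; field_simp
  rw [hc, hs] at h
  generalize log ((a ^ 2 + b ^ 2) / (2 * (a * b))) = L at *
  generalize log (a / b) = u at *
  have h2 := mul_nonneg (mul_pos ha hb).le h
  have e : a * b * (3 / 2 * (u * ((a ^ 2 - b ^ 2) / (2 * (a * b))))
      - (a ^ 2 + b ^ 2) / (2 * (a * b)) * L - 2 * ((a ^ 2 + b ^ 2) / (2 * (a * b)) - 1))
      = 3 / 4 * ((a ^ 2 - b ^ 2) * u) - (a ^ 2 + b ^ 2) / 2 * L - (a - b) ^ 2 := by
    field_simp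
    ring
  rw [e] at h2
  push_cast
  linarith

theorem stmt_13 (n : ℕ) (hn : 2 ≤ n) (p q : Fin n → ℝ)
    (hp : ∀ i, 0 < p i) (hq : ∀ i, 0 < q i)
    (hps : ∑ i, p i = 1) (hqs : ∑ i, q i = 1) :
    agDiv p q - hellingerD p q ≤ 3 * ((1 / 8) * jDiv p q - hellingerD p q) := by
  have h := Finset.sum_le_sum (s := Finset.univ)
    (fun i _ => aux_term (p i) (q i) (hp i) (hq i))
  rw [Finset.sum_add_distrib, ← Finset.mul_sum] at h
  unfold agDiv hellingerD jDiv
  linarith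
end

section
/- For every n ≥ 2 and all P, Q ∈ Γ_n, one has (1/8)·J(P‖Q) − h(P‖Q) ≤ (1/12)·[(1/16)·Ψ(P‖Q) − (1/4)·Δ(P‖Q)]. -/
open Real BigOperators

lemma aux_poly (t : ℝ) (ht : 0 < t) :
    24 * t ^ 2 * (t ^ 2 + 1) ^ 2 ≤ (t + 1) ^ 4 * (t ^ 4 + 4 * t ^ 2 + 1) := by
  have h1 : 0 ≤ ((t + 1) ^ 2) ^ 2 - 8 * t * (t ^ 2 + 1) := by
    have : ((t + 1) ^ 2) ^ 2 - 8 * t * (t ^ 2 + 1) = ((t - 1) ^ 2) ^ 2 := by ring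
    rw [this]; positivity
  have h2 : 0 ≤ (t ^ 4 + 4 * t ^ 2 + 1) - 3 * t * (t ^ 2 + 1) := by
    have : (t ^ 4 + 4 * t ^ 2 + 1) - 3 * t * (t ^ 2 + 1)
      = (t - 1) ^ 2 * (t ^ 2 - t + 1) := by ring
    rw [this]
    have : 0 < t ^ 2 - t + 1 := by nlinarith [sq_nonneg (t - 1)]
    positivity
  have h3 : 0 ≤ t ^ 4 + 4 * t ^ 2 + 1 := by positivity
  have h4 : 0 ≤ 8 * t * (t ^ 2 + 1) := by positivity
  nlinarith [mul_nonneg h1 h3, mul_nonneg h4 h2]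

noncomputable def auxF (t : ℝ) : ℝ :=
  2 * (t - 1) / (t + 1) + (t ^ 2 - 1) ^ 3 / (48 * (t ^ 2 * (t ^ 2 + 1))) - Real.log t

noncomputable def auxF' (t : ℝ) : ℝ :=
  (t - 1) ^ 2 * ((t + 1) ^ 4 * (t ^ 4 + 4 * t ^ 2 + 1) - 24 * t ^ 2 * (t ^ 2 + 1) ^ 2) /
    (24 * t ^ 3 * (t ^ 2 + 1) ^ 2 * (t + 1) ^ 2)

lemma auxF_deriv (t : ℝ) (ht : 0 < t) : HasDerivAt auxF (auxF' t) t := by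
  have hi := hasDerivAt_id t
  have h1 : HasDerivAt (fun t : ℝ => 2 * (t - 1) / (t + 1)) _ t :=
    ((hi.sub_const 1).const_mul 2).div (hi.add_const 1) (by show t + 1 ≠ 0; positivity)
  have h2 : HasDerivAt (fun t : ℝ => (t ^ 2 - 1) ^ 3 / (48 * (t ^ 2 * (t ^ 2 + 1)))) _ t :=
    (((hi.pow 2).sub_const 1).pow 3).div
      (((hi.pow 2).mul ((hi.pow 2).add_const 1)).const_mul 48)
      (by show 48 * (t ^ 2 * (t ^ 2 + 1)) ≠ 0; positivity)
  have h3 := (h1.add h2).sub (Real.hasDerivAt_log ht.ne')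
  refine HasDerivAt.congr_deriv h3 ?_
  simp [auxF']
  field_simp
  ring

lemma auxF_mono : MonotoneOn auxF (Set.Ioi 0) := by
  apply monotoneOn_of_deriv_nonneg (convex_Ioi 0)
  · intro t ht
    exact (auxF_deriv t ht).continuousAt.continuousWithinAt
  · intro t ht
    rw [interior_Ioi] at ht
    exact (auxF_deriv t ht).differentiableAt.differentiableWithinAt
  · intro t ht
    rw [interior_Ioi] at ht
    rw [(auxF_deriv t ht).deriv]
    have h0 : 0 < t := ht
    have := sub_nonneg.2 (aux_poly t h0)
    unfold auxF'
    positivity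

lemma aux_mul (t : ℝ) (ht : 0 < t) : 0 ≤ (t ^ 2 - 1) * auxF t := by
  have h1 : auxF 1 = 0 := by simp [auxF]
  rcases le_total 1 t with h | h
  · have := auxF_mono (Set.mem_Ioi.2 one_pos) (Set.mem_Ioi.2 ht) h
    exact mul_nonneg (by nlinarith) (by linarith)
  · have := auxF_mono (Set.mem_Ioi.2 ht) (Set.mem_Ioi.2 one_pos) h
    exact mul_nonneg_of_nonpos_of_nonpos (by nlinarith) (by linarith)

lemma aux_point (x y : ℝ) (hx : 0 < x) (hy : 0 < y) :
    (1 / 8) * ((x - y) * Real.log (x / y)) - (1 / 2) * (Real.sqrt x - Real.sqrt y) ^ 2 ≤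
    (1 / 12) * ((1 / 16) * ((x - y) ^ 2 * (x + y) / (x * y))
      - (1 / 4) * ((x - y) ^ 2 / (x + y))) := by
  obtain ⟨a, ha, rfl⟩ : ∃ a, 0 < a ∧ a ^ 2 = x := ⟨√x, Real.sqrt_pos.2 hx, Real.sq_sqrt hx.le⟩
  obtain ⟨b, hb, rfl⟩ : ∃ a, 0 < a ∧ a ^ 2 = y := ⟨√y, Real.sqrt_pos.2 hy, Real.sq_sqrt hy.le⟩
  rw [Real.sqrt_sq ha.le, Real.sqrt_sq hb.le, ← div_pow, Real.log_pow]
  have h := mul_nonneg (sq_nonneg b) (aux_mul (a / b) (div_pos ha hb))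
  unfold auxF at h
  generalize Real.log (a / b) = L at *
  have key : (1 / 12) * ((1 / 16) * ((a ^ 2 - b ^ 2) ^ 2 * (a ^ 2 + b ^ 2) / (a ^ 2 * b ^ 2))
      - (1 / 4) * ((a ^ 2 - b ^ 2) ^ 2 / (a ^ 2 + b ^ 2)))
      - ((1 / 8) * ((a ^ 2 - b ^ 2) * ((2 : ℕ) * L)) - (1 / 2) * (a - b) ^ 2) =
      (1 / 4) * (b ^ 2 * (((a / b) ^ 2 - 1) * (2 * (a / b - 1) / (a / b + 1) +
       ((a / b) ^ 2 - 1) ^ 3 / (48 * ((a / b) ^ 2 * ((a / b) ^ 2 + 1))) - L))) := by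
    push_cast
    field_simp
    ring
  linarith

theorem stmt_14 (n : ℕ) (hn : 2 ≤ n) (p q : Fin n → ℝ)
    (hp : ∀ i, 0 < p i) (hq : ∀ i, 0 < q i)
    (hps : ∑ i, p i = 1) (hqs : ∑ i, q i = 1) :
    (1 / 8) * jDiv p q - hellingerD p q ≤ (1 / 12) * ((1 / 16) * symChiSqD p q - (1 / 4) * triangularD p q) := by
  unfold jDiv hellingerD symChiSqD triangularD
  simp only [Finset.mul_sum, ← Finset.sum_sub_distrib]
  exact Finset.sum_le_sum fun i _ => aux_point (p i) (q i) (hp i) (hq i)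
end

section
/- For every n ≥ 2 and all P, Q ∈ Γ_n, one has (1/16)·Ψ(P‖Q) − (1/8)·J(P‖Q) ≤ (4/3)·[(1/16)·Ψ(P‖Q) − T(P‖Q)]. -/
open Real BigOperators

theorem aux_h (x : ℝ) (hx : 1 ≤ x) :
    0 ≤ 12 * Real.log x + x ^ 2 - 8 * x + 8 * x⁻¹ - (x ^ 2)⁻¹ := by
  have hd : ∀ y : ℝ, 0 < y → HasDerivAt
      (fun x : ℝ => 12 * Real.log x + x ^ 2 - 8 * x + 8 * x⁻¹ - (x ^ 2)⁻¹)
      (2 * (y - 1) ^ 4 / y ^ 3) y := by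
    intro y hy
    have h0 : y ≠ 0 := hy.ne'
    have := (((((Real.hasDerivAt_log h0).const_mul 12).add (hasDerivAt_pow 2 y)).sub
      ((hasDerivAt_id y).const_mul 8)).add ((hasDerivAt_inv h0).const_mul 8)).sub
      ((hasDerivAt_pow 2 y).inv (pow_ne_zero 2 h0))
    refine this.congr_deriv ?_
    field_simp
    push_cast
    ring
  have hm : MonotoneOn (fun x : ℝ => 12 * Real.log x + x ^ 2 - 8 * x + 8 * x⁻¹ - (x ^ 2)⁻¹)
      (Set.Ici 1) := by
    apply monotoneOn_of_hasDerivWithinAt_nonneg (f' := fun y => 2 * (y - 1) ^ 4 / y ^ 3)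
      (convex_Ici 1)
    · intro y hy
      exact (hd y (by have := Set.mem_Ici.1 hy; linarith)).continuousAt.continuousWithinAt
    · intro y hy
      rw [interior_Ici] at hy
      exact (hd y (by have := Set.mem_Ioi.1 hy; linarith)).hasDerivWithinAt
    · intro y hy
      rw [interior_Ici] at hy
      have : 0 < y := by have := Set.mem_Ioi.1 hy; linarith
      positivity
  have := hm (Set.mem_Ici.2 le_rfl) (Set.mem_Ici.2 hx) hx
  norm_num at this
  linarith

theorem aux_F (x : ℝ) (hx : 1 ≤ x) :
    0 ≤ x - 2 + x⁻¹ - 32 * Real.log ((x + 1) / 2) + 16 * Real.log x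
      + 6 * ((x - 1) / (x + 1) * Real.log x) := by
  have hd : ∀ y : ℝ, 0 < y → HasDerivAt
      (fun x : ℝ => x - 2 + x⁻¹ - 32 * Real.log ((x + 1) / 2) + 16 * Real.log x
      + 6 * ((x - 1) / (x + 1) * Real.log x))
      ((12 * Real.log y + y ^ 2 - 8 * y + 8 * y⁻¹ - (y ^ 2)⁻¹) / (y + 1) ^ 2) y := by
    intro y hy
    have h0 : y ≠ 0 := hy.ne'
    have h1 : y + 1 ≠ 0 := by positivity
    have h2 : (y + 1) / 2 ≠ 0 := by positivity
    have hid := hasDerivAt_id y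
    have := (((((hid.sub_const 2).add (hasDerivAt_inv h0)).sub
      ((((hid.add_const 1).div_const 2).log h2).const_mul 32)).add
      ((Real.hasDerivAt_log h0).const_mul 16)).add
      ((((hid.sub_const 1).div (hid.add_const 1) h1).mul
        (Real.hasDerivAt_log h0)).const_mul 6))
    refine this.congr_deriv ?_
    simp only [id, Pi.div_apply]
    field_simp
    ring
  have hm : MonotoneOn (fun x : ℝ => x - 2 + x⁻¹ - 32 * Real.log ((x + 1) / 2) + 16 * Real.log x
      + 6 * ((x - 1) / (x + 1) * Real.log x))
      (Set.Ici 1) := by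
    apply monotoneOn_of_hasDerivWithinAt_nonneg (f' := fun y =>
      (12 * Real.log y + y ^ 2 - 8 * y + 8 * y⁻¹ - (y ^ 2)⁻¹) / (y + 1) ^ 2)
      (convex_Ici 1)
    · intro y hy
      exact (hd y (by have := Set.mem_Ici.1 hy; linarith)).continuousAt.continuousWithinAt
    · intro y hy
      rw [interior_Ici] at hy
      exact (hd y (by have := Set.mem_Ioi.1 hy; linarith)).hasDerivWithinAt
    · intro y hy
      rw [interior_Ici] at hy
      have := aux_h y (Set.mem_Ioi.1 hy).le
      positivity
  have := hm (Set.mem_Ici.2 le_rfl) (Set.mem_Ici.2 hx) hx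
  norm_num at this
  linarith

theorem aux_pt (a b : ℝ) (ha : 0 < a) (hb : 0 < b) (hba : b ≤ a) :
    0 ≤ (a - b) ^ 2 * (a + b) / (a * b) + 6 * ((a - b) * Real.log (a / b))
      - 64 * (((a + b) / 2) * Real.log ((a + b) / (2 * Real.sqrt (a * b)))) := by
  have hF := aux_F (a / b) ((one_le_div hb).2 hba)
  have hs : 0 < Real.sqrt (a * b) := Real.sqrt_pos.2 (by positivity)
  have e1 : Real.log ((a + b) / (2 * Real.sqrt (a * b)))
      = Real.log (a + b) - Real.log 2 - (Real.log a + Real.log b) / 2 := by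
    rw [Real.log_div (by positivity) (by positivity), Real.log_mul (by norm_num) hs.ne',
      Real.log_sqrt (by positivity), Real.log_mul ha.ne' hb.ne']
    ring
  have e2 : Real.log ((a / b + 1) / 2) = Real.log (a + b) - Real.log b - Real.log 2 := by
    rw [show (a / b + 1) / 2 = (a + b) / b / 2 by field_simp,
      Real.log_div (by positivity) (by norm_num), Real.log_div (by positivity) hb.ne']
  rw [e2, Real.log_div ha.ne' hb.ne'] at hF
  rw [e1, Real.log_div ha.ne' hb.ne']
  have := mul_nonneg (add_pos ha hb).le hF
  refine this.trans_eq ?_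
  have hab : a + b ≠ 0 := by positivity
  have e3 : (a / b - 1) / (a / b + 1) = (a - b) / (a + b) := by field_simp
  rw [e3]
  field_simp
  ring

theorem aux_all (a b : ℝ) (ha : 0 < a) (hb : 0 < b) :
    0 ≤ (a - b) ^ 2 * (a + b) / (a * b) + 6 * ((a - b) * Real.log (a / b))
      - 64 * (((a + b) / 2) * Real.log ((a + b) / (2 * Real.sqrt (a * b)))) := by
  rcases le_total b a with h | h
  · exact aux_pt a b ha hb h
  · have := aux_pt b a hb ha h
    rw [Real.log_div hb.ne' ha.ne', add_comm b a, mul_comm b a] at this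
    rw [Real.log_div ha.ne' hb.ne']
    refine this.trans_eq ?_
    ring

theorem stmt_18 (n : ℕ) (hn : 2 ≤ n) (p q : Fin n → ℝ)
    (hp : ∀ i, 0 < p i) (hq : ∀ i, 0 < q i)
    (hps : ∑ i, p i = 1) (hqs : ∑ i, q i = 1) :
    (1 / 16) * symChiSqD p q - (1 / 8) * jDiv p q ≤ (4 / 3) * ((1 / 16) * symChiSqD p q - agDiv p q) := by
  have h : 0 ≤ symChiSqD p q + 6 * jDiv p q - 64 * agDiv p q := by
    unfold symChiSqD jDiv agDiv
    rw [Finset.mul_sum, Finset.mul_sum, ← Finset.sum_add_distrib, ← Finset.sum_sub_distrib]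
    exact Finset.sum_nonneg fun i _ => aux_all (p i) (q i) (hp i) (hq i)
  linarith
end
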